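/- Let P be a positive random field on X^{ℤ^d} that is Markov with respect to a neighborhood system ∂ = (∂t)_{t∈ℤ^d} (each ∂t a finite subset of ℤ^d with t ∉ ∂t, and s ∈ ∂t iff t ∈ ∂s): for every t ∈ ℤ^d, every finite Λ ⊂ ℤ^d∖{t} with ∂t ⊆ Λ, and all z, y ∈ X^Λ with z_{∂t} = y_{∂t}, one has g_t^z(x) = g_t^y(x) for all x ∈ X. Then P is a Gibbs random field. -/

import Mathlib

open MeasureTheory Filter Topology

noncomputable section

/-- Sites of the lattice `ℤ^d`. -/
abbrev Site (d : ℕ) := Fin d → ℤ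

/-- Configurations on the whole lattice. -/
abbrev Config (d : ℕ) (X : Type*) := Site d → X

variable {d : ℕ} {X : Type*}

/-- The configuration equal to `x` on `V` and to `z` off `V` (the concatenation `xz`). -/
def concat (V : Finset (Site d)) (x z : Config d X) : Config d X :=
  fun t => if t ∈ V then x t else z t

/-- The configuration equal to `u` on `I` and to `y` off `I`. -/
def extCfg (I : Finset (Site d)) (u : {s // s ∈ I} → X) (y : Config d X) : Config d X :=
  fun t => if h : t ∈ I then u ⟨t, h⟩ else y t

/-- The cylinder set determined by the values of `z` on `Λ`. -/
def cyl (Λ : Finset (Site d)) (z : Config d X) : Set (Config d X) :=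
  {ω | ∀ t ∈ Λ, ω t = z t}

/-- Finite-dimensional distribution `P_Λ(z)`. -/
def fdd [MeasurableSpace X] (P : Measure (Config d X)) (Λ : Finset (Site d))
    (z : Config d X) : ℝ :=
  (P (cyl Λ z)).toReal

/-- A positive random field: all finite-dimensional distributions are positive. -/
def IsPositiveRF [MeasurableSpace X] (P : Measure (Config d X)) : Prop :=
  ∀ Λ : Finset (Site d), Λ.Nonempty → ∀ z : Config d X, 0 < fdd P Λ z

/-- Finite-conditional probability `g_V^z(x)` with boundary condition `z` on `Λ`. -/
def gfin [MeasurableSpace X] (P : Measure (Config d X)) (V Λ : Finset (Site d))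
    (x z : Config d X) : ℝ :=
  fdd P (V ∪ Λ) (concat V x z) / fdd P Λ z

/-- A filtration: an increasing sequence of finite subsets of the lattice with union `ℤ^d`. -/
structure Filt (d : ℕ) where
  Λ : ℕ → Finset (Site d)
  mono : Monotone Λ
  covers : ∀ t : Site d, ∃ n, t ∈ Λ n

/-- The set `𝒳_V(F)` of admissible boundary conditions: those `x̄` for which all the limits
`lim_n g_V^{x̄_{Λ_n ∖ V}}(x)` exist. (Only the values of `x̄` off `V` are ever used.) -/
def admissible [MeasurableSpace X] (P : Measure (Config d X)) (V : Finset (Site d))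
    (F : Filt d) : Set (Config d X) :=
  {xb | ∀ x : Config d X, ∃ L : ℝ,
    Tendsto (fun n => gfin P V (F.Λ n \ V) x xb) atTop (𝓝 L)}

/-- The conditional probability `g_V^{x̄}(x)` : the limit of `g_V^{x̄_{Λ_n ∖ V}}(x)`. -/
def gCond [MeasurableSpace X] (P : Measure (Config d X)) (V : Finset (Site d))
    (F : Filt d) (xb x : Config d X) : ℝ :=
  limUnder atTop (fun n => gfin P V (F.Λ n \ V) x xb)

/-- Transition energy `Δ_V^{x̄}(x,u) = ln (g_V^{x̄}(x) / g_V^{x̄}(u))`. -/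
def TE [MeasurableSpace X] (P : Measure (Config d X)) (V : Finset (Site d))
    (F : Filt d) (xb x u : Config d X) : ℝ :=
  Real.log (gCond P V F xb x / gCond P V F xb u)

/-- Quasilocality (on boundary conditions off `V`) of a function `h` on a set `Y` of
boundary conditions. -/
def QuasilocalOn (V : Finset (Site d)) (Y : Set (Config d X)) (h : Config d X → ℝ) : Prop :=
  ∀ ε > 0, ∃ Λε : Finset (Site d), Disjoint Λε V ∧
    ∀ Λ : Finset (Site d), Disjoint Λ V → Λε ⊆ Λ →
      ∀ xb ∈ Y, ∀ yb ∈ Y, (∀ s ∈ Λ, xb s = yb s) → |h xb - h yb| < ε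

/-- `Y` represents a set of boundary conditions on `ℤ^d ∖ {t}`: membership does not depend
on the value at `t`. -/
def IsBCSet (t : Site d) (Y : Set (Config d X)) : Prop :=
  ∀ (ω : Config d X) (a : X), ω ∈ Y → Function.update ω t a ∈ Y

/-- `F` is a determining filtration for `P` with sets `Y t` of admissible boundary conditions:
the one-point finite-conditional probabilities converge, uniformly over `Y t`, to positive
limits, and `P(Y t) = 1`. -/
structure IsDetermining [MeasurableSpace X] (P : Measure (Config d X)) (F : Filt d)
    (Y : Site d → Set (Config d X)) : Prop where
  meas : ∀ t, MeasurableSet (Y t)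
  bc : ∀ t, IsBCSet t (Y t)
  adm : ∀ t, Y t ⊆ admissible P {t} F
  full : ∀ t, P (Y t) = 1
  pos : ∀ t, ∀ xb ∈ Y t, ∀ x : X, 0 < gCond P {t} F xb (fun _ => x)
  unif : ∀ (t : Site d) (x : X), ∀ ε > 0, ∃ N, ∀ n ≥ N, ∀ xb ∈ Y t,
    |gfin P {t} (F.Λ n \ {t}) (fun _ => x) xb - gCond P {t} F xb (fun _ => x)| < ε

/-- The probabilistic (Pr--) definition of a Gibbs random field. -/
def IsGibbsRF [MeasurableSpace X] (P : Measure (Config d X)) : Prop :=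
  IsProbabilityMeasure P ∧ IsPositiveRF P ∧
    ∃ (F : Filt d) (Y : Site d → Set (Config d X)), IsDetermining P F Y

section MarkovFields

variable [MeasurableSpace X]

theorem measurableSet_cyl [MeasurableSingletonClass X] (Λ : Finset (Site d)) (z : Config d X) :
    MeasurableSet (cyl Λ z) := by
  have h : cyl Λ z = ⋂ t ∈ Λ, (fun ω : Config d X => ω t) ⁻¹' {z t} := by
    ext ω
    simp [cyl]
  rw [h]
  exact Finset.measurableSet_biInter Λ fun t _ =>
    measurable_pi_apply t (measurableSet_singleton (z t))

/-- Consistency of the finite-dimensional distributions under the addition of one site. -/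
theorem fdd_eq_sum_update [Fintype X] [MeasurableSingletonClass X] (P : Measure (Config d X))
    [IsFiniteMeasure P] {Λ : Finset (Site d)} {s : Site d} (hs : s ∉ Λ) (z : Config d X) :
    fdd P Λ z = ∑ a : X, fdd P (insert s Λ) (Function.update z s a) := by
  have hmem : ∀ (a : X) (ω : Config d X),
      ω ∈ cyl (insert s Λ) (Function.update z s a) ↔ ω s = a ∧ ω ∈ cyl Λ z := by
    intro a ω
    simp only [cyl, Set.mem_ofPred_eq, Finset.forall_mem_insert, Function.update_self]
    refine and_congr_right fun _ => forall₂_congr fun r hr => ?_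
    rw [Function.update_of_ne (ne_of_mem_of_not_mem hr hs)]
  have hunion : cyl Λ z = ⋃ a ∈ (Finset.univ : Finset X),
      cyl (insert s Λ) (Function.update z s a) := by
    ext ω
    simp [hmem]
  have hdisj : Set.PairwiseDisjoint ((Finset.univ : Finset X) : Set X)
      fun a => cyl (insert s Λ) (Function.update z s a) := by
    intro a _ b _ hab
    refine Set.disjoint_left.2 fun ω ha hb => hab ?_
    rw [← ((hmem a ω).1 ha).1, ← ((hmem b ω).1 hb).1]
  unfold fdd
  rw [hunion, measure_biUnion_finset hdisj fun a _ => measurableSet_cyl _ _,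
    ENNReal.toReal_sum fun a _ => measure_ne_top P _]

theorem fdd_pos {P : Measure (Config d X)} [IsProbabilityMeasure P] (hP : IsPositiveRF P)
    (Λ : Finset (Site d)) (z : Config d X) : 0 < fdd P Λ z := by
  rcases Λ.eq_empty_or_nonempty with rfl | h
  · simp [fdd, cyl]
  · exact hP Λ h z

theorem gfin_pos {P : Measure (Config d X)} [IsProbabilityMeasure P] (hP : IsPositiveRF P)
    (V Λ : Finset (Site d)) (x z : Config d X) : 0 < gfin P V Λ x z :=
  div_pos (fdd_pos hP _ _) (fdd_pos hP _ _)

theorem gfin_singleton_const (P : Measure (Config d X)) (t : Site d) (Λ : Finset (Site d))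
    (x z : Config d X) : gfin P {t} Λ x z = gfin P {t} Λ (fun _ => x t) z := by
  have h : concat {t} x z = concat {t} (fun _ => x t) z := by
    funext r
    by_cases hr : r = t <;> simp [concat, hr]
  unfold gfin
  rw [h]

/-- If a one-point finite-conditional probability does not depend on the boundary value at `s`,
then `s` can be removed from the boundary condition. -/
theorem gfin_insert_eq [Fintype X] [MeasurableSingletonClass X] {P : Measure (Config d X)}
    [IsProbabilityMeasure P] (hP : IsPositiveRF P) {t s : Site d} {Λ : Finset (Site d)}
    (hst : s ≠ t) (hs : s ∉ Λ) (x z : Config d X)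
    (h : ∀ a : X, gfin P {t} (insert s Λ) x (Function.update z s a) =
      gfin P {t} (insert s Λ) x z) :
    gfin P {t} (insert s Λ) x z = gfin P {t} Λ x z := by
  have hconcat : ∀ a : X, concat {t} x (Function.update z s a) =
      Function.update (concat {t} x z) s a := by
    intro a
    funext r
    rcases eq_or_ne r s with rfl | hr
    · simp [concat, hst]
    · simp [concat, Function.update_of_ne hr]
  have hmul : ∀ a : X,
      fdd P (insert s ({t} ∪ Λ)) (Function.update (concat {t} x z) s a) =
        gfin P {t} (insert s Λ) x z * fdd P (insert s Λ) (Function.update z s a) := by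
    intro a
    rw [← h a, gfin, hconcat, Finset.union_insert, div_mul_cancel₀ _ (fdd_pos hP _ _).ne']
  have hs' : s ∉ {t} ∪ Λ := by simp [hst, hs]
  conv_rhs => rw [gfin]
  rw [eq_div_iff (fdd_pos hP Λ z).ne', fdd_eq_sum_update P hs z,
    fdd_eq_sum_update P hs' (concat {t} x z), Finset.mul_sum]
  exact Finset.sum_congr rfl fun a _ => (hmul a).symm

/-- For a Markov field, only the neighborhood matters in a one-point conditional probability. -/
theorem gfin_eq_gfin_nbr [Fintype X] [MeasurableSingletonClass X] {P : Measure (Config d X)}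
    [IsProbabilityMeasure P] (hP : IsPositiveRF P) {t : Site d} {N : Finset (Site d)}
    (hMarkov : ∀ Λ : Finset (Site d), t ∉ Λ → N ⊆ Λ →
      ∀ z y : Config d X, (∀ s ∈ N, z s = y s) →
        ∀ x : X, gfin P {t} Λ (fun _ => x) z = gfin P {t} Λ (fun _ => x) y)
    {Λ : Finset (Site d)} (ht : t ∉ Λ) (hN : N ⊆ Λ) (x : X) (z : Config d X) :
    gfin P {t} Λ (fun _ => x) z = gfin P {t} N (fun _ => x) z := by
  have key : ∀ M : Finset (Site d), Disjoint M N → t ∉ M ∪ N →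
      gfin P {t} (M ∪ N) (fun _ => x) z = gfin P {t} N (fun _ => x) z := by
    intro M
    induction M using Finset.induction_on with
    | empty => simp
    | insert s M hsM ih =>
      intro hdisj htM
      rw [Finset.disjoint_insert_left] at hdisj
      rw [Finset.insert_union] at htM ⊢
      have htM' : t ∉ M ∪ N := fun h => htM (Finset.mem_insert_of_mem h)
      have hst : s ≠ t := by
        rintro rfl
        exact htM (Finset.mem_insert_self _ _)
      rw [gfin_insert_eq hP hst (by simp [hsM, hdisj.1]), ih hdisj.2 htM']
      intro a
      refine hMarkov _ htM
        (Finset.subset_union_right.trans (Finset.subset_insert _ _)) _ _ (fun r hr => ?_) x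
      exact Function.update_of_ne (ne_of_mem_of_not_mem hr hdisj.1) _ _
  have h := key (Λ \ N) Finset.sdiff_disjoint
  rw [Finset.sdiff_union_of_subset hN] at h
  exact h ht

end MarkovFields

theorem exists_filt_eventually_subset (d : ℕ) :
    ∃ F : Filt d, ∀ S : Finset (Site d), ∃ n₀, ∀ n ≥ n₀, S ⊆ F.Λ n := by
  obtain ⟨u, hmono, htends⟩ := exists_seq_monotone_tendsto_atTop_atTop (Finset (Site d))
  have h : ∀ S : Finset (Site d), ∃ n₀, ∀ n ≥ n₀, S ⊆ u n := fun S =>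
    eventually_atTop.1 (htends.eventually_ge_atTop S)
  refine ⟨⟨u, hmono, fun t => ?_⟩, h⟩
  obtain ⟨n, hn⟩ := h {t}
  exact ⟨n, Finset.singleton_subset_iff.1 (hn n le_rfl)⟩

/-- every positive Markov random field (w.r.t. a neighborhood system) is a
Gibbs random field. -/
theorem stmt17 [Fintype X] [Nontrivial X] [MeasurableSpace X] [MeasurableSingletonClass X]
    (P : Measure (Config d X)) [IsProbabilityMeasure P] (hP : IsPositiveRF P)
    (nbr : Site d → Finset (Site d)) (hself : ∀ t, t ∉ nbr t)
    (hsym : ∀ t s : Site d, s ∈ nbr t ↔ t ∈ nbr s)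
    (hMarkov : ∀ (t : Site d) (Λ : Finset (Site d)), t ∉ Λ → nbr t ⊆ Λ →
      ∀ z y : Config d X, (∀ s ∈ nbr t, z s = y s) →
        ∀ x : X, gfin P {t} Λ (fun _ => x) z = gfin P {t} Λ (fun _ => x) y) :
    IsGibbsRF P := by
  obtain ⟨F, hF⟩ := exists_filt_eventually_subset d
  have hconst : ∀ t : Site d, ∃ n₀, ∀ n ≥ n₀, ∀ (x : X) (z : Config d X),
      gfin P {t} (F.Λ n \ {t}) (fun _ => x) z = gfin P {t} (nbr t) (fun _ => x) z := by
    intro t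
    obtain ⟨n₀, hn₀⟩ := hF (nbr t)
    refine ⟨n₀, fun n hn x z => gfin_eq_gfin_nbr hP (hMarkov t) (by simp) ?_ x z⟩
    exact Finset.subset_sdiff.2 ⟨hn₀ n hn, Finset.disjoint_singleton_right.2 (hself t)⟩
  have hlim : ∀ (t : Site d) (x : X) (z : Config d X),
      Tendsto (fun n => gfin P {t} (F.Λ n \ {t}) (fun _ => x) z) atTop
        (𝓝 (gfin P {t} (nbr t) (fun _ => x) z)) := by
    intro t x z
    obtain ⟨n₀, hn₀⟩ := hconst t
    exact tendsto_atTop_of_eventually_const fun n hn => hn₀ n hn x z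
  have hgCond : ∀ (t : Site d) (x : X) (z : Config d X),
      gCond P {t} F z (fun _ => x) = gfin P {t} (nbr t) (fun _ => x) z :=
    fun t x z => (hlim t x z).limUnder_eq
  refine ⟨inferInstance, hP, F, fun _ => Set.univ, ?_⟩
  refine
    { meas := fun _ => MeasurableSet.univ
      bc := fun _ _ _ _ => Set.mem_univ _
      adm := fun t z _ x => ⟨gfin P {t} (nbr t) (fun _ => x t) z, ?_⟩
      full := fun _ => measure_univ
      pos := fun t z _ x => ?_
      unif := fun t x ε hε => ?_ }
  · simp_rw [gfin_singleton_const P t _ x z]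
    exact hlim t (x t) z
  · rw [hgCond]
    exact gfin_pos hP _ _ _ _
  · obtain ⟨n₀, hn₀⟩ := hconst t
    refine ⟨n₀, fun n hn z _ => ?_⟩
    rwa [hgCond, hn₀ n hn, sub_self, abs_zero]
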